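/- Let k ≥ 1 be an integer and let a be a real number with 0 < a < 1. Then the function (t_1, …, t_k) ↦ 1/((1 − t_1)·t_2·⋯·t_k) is integrable (with respect to Lebesgue measure on ℝ^k) on the open simplex {(t_1, …, t_k) : 0 < t_1 < t_2 < ⋯ < t_k < a}, and its integral over this simplex equals the k-th polylogarithm value Li_k(a) = ∑_{n=1}^∞ a^n / n^k. -/

import Mathlib

open MeasureTheory

/-- The open simplex `{0 < t₀ < ⋯ < t_{n-1} < a}`. -/
def openSimplex (n : ℕ) (a : ℝ) : Set (Fin n → ℝ) :=
  {t | (∀ i, 0 < t i ∧ t i < a) ∧ StrictMono t}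

/-- The integrand `1 / ((1 - t₀) t₁ ⋯ t_m)` of the iterated integral for `Li_{m+1}`. -/
noncomputable def polylogIntegrand (m : ℕ) (t : Fin (m + 1) → ℝ) : ℝ :=
  ((1 - t 0) * ∏ i : Fin m, t i.succ)⁻¹

theorem measurableSet_setOf_mem_openSimplex {α : Type*} [MeasurableSpace α] {n : ℕ}
    {f : α → Fin n → ℝ} {g : α → ℝ} (hf : Measurable f) (hg : Measurable g) :
    MeasurableSet {x | f x ∈ openSimplex n (g x)} := by
  have hfi (i : Fin n) : Measurable fun x => f x i := (measurable_pi_apply i).comp hf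
  have h : {x | f x ∈ openSimplex n (g x)} =
      (⋂ i, {x | 0 < f x i} ∩ {x | f x i < g x}) ∩
        ⋂ i, ⋂ j, ⋂ _ : i < j, {x | f x i < f x j} := by
    ext x
    simp [openSimplex, StrictMono]
  rw [h]
  refine MeasurableSet.inter (MeasurableSet.iInter fun i => ?_)
    (MeasurableSet.iInter fun i => MeasurableSet.iInter fun j => MeasurableSet.iInter fun _ => ?_)
  · exact (measurableSet_lt measurable_const (hfi i)).inter (measurableSet_lt (hfi i) hg)
  · exact measurableSet_lt (hfi i) (hfi j)

theorem measurableSet_openSimplex (n : ℕ) (a : ℝ) : MeasurableSet (openSimplex n a) :=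
  measurableSet_setOf_mem_openSimplex measurable_id measurable_const

theorem measurable_polylogIntegrand (m : ℕ) : Measurable (polylogIntegrand m) := by
  unfold polylogIntegrand
  fun_prop

theorem polylogIntegrand_nonneg {m : ℕ} {a : ℝ} (ha : a ≤ 1) {t : Fin (m + 1) → ℝ}
    (ht : t ∈ openSimplex (m + 1) a) : 0 ≤ polylogIntegrand m t :=
  inv_nonneg.2 <| mul_nonneg (by linarith [(ht.1 0).2])
    (Finset.prod_nonneg fun i _ => (ht.1 i.succ).1.le)

theorem mem_openSimplex_succ_iff {n : ℕ} {a : ℝ} {t : Fin (n + 1) → ℝ} :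
    t ∈ openSimplex (n + 1) a ↔
      t (Fin.last n) ∈ Set.Ioo 0 a ∧
        (fun i : Fin n => t i.castSucc) ∈ openSimplex n (t (Fin.last n)) := by
  constructor
  · rintro ⟨h, hm⟩
    exact ⟨h _, fun i => ⟨(h _).1, hm i.castSucc_lt_last⟩,
      fun i j hij => hm (Fin.castSucc_lt_castSucc_iff.2 hij)⟩
  · rintro ⟨hl, h, hm⟩
    refine ⟨fun i => ?_, fun i j hij => ?_⟩
    · induction i using Fin.lastCases with
      | last => exact hl
      | cast i => exact ⟨(h i).1, (h i).2.trans hl.2⟩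
    · induction i using Fin.lastCases with
      | last => exact absurd hij (not_lt.2 (Fin.le_last j))
      | cast i =>
        induction j using Fin.lastCases with
        | last => exact (h i).2
        | cast j => exact hm (Fin.castSucc_lt_castSucc_iff.1 hij)

theorem polylogIntegrand_succ (m : ℕ) (t : Fin (m + 2) → ℝ) :
    polylogIntegrand (m + 1) t =
      (t (Fin.last (m + 1)))⁻¹ * polylogIntegrand m (fun i => t i.castSucc) := by
  simp only [polylogIntegrand, Fin.prod_univ_castSucc, Fin.succ_last, Fin.succ_castSucc,
    Fin.castSucc_zero, mul_inv]
  ring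

theorem lintegral_Ioo_const_mul_pow {a c : ℝ} (ha : 0 ≤ a) (hc : 0 ≤ c) (n : ℕ) :
    ∫⁻ x in Set.Ioo 0 a, ENNReal.ofReal (c * x ^ n) =
      ENNReal.ofReal (c * (a ^ (n + 1) / (n + 1))) := by
  rw [Measure.restrict_congr_set Ioo_ae_eq_Ioc, ← ofReal_integral_eq_lintegral_ofReal,
    ← intervalIntegral.integral_of_le ha]
  · simp
  · exact (by fun_prop : Continuous fun x : ℝ => c * x ^ n).integrableOn_Ioc
  · filter_upwards [ae_restrict_mem measurableSet_Ioc] with x hx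
    exact mul_nonneg hc (pow_nonneg hx.1.le n)

theorem lintegral_Ioo_inv_one_sub {a : ℝ} (ha0 : 0 ≤ a) (ha1 : a ≤ 1) :
    ∫⁻ x in Set.Ioo 0 a, ENNReal.ofReal (1 - x)⁻¹ =
      ∑' n : ℕ, ENNReal.ofReal (a ^ (n + 1) / ((n : ℝ) + 1)) := by
  have h : ∫⁻ x in Set.Ioo 0 a, ENNReal.ofReal (1 - x)⁻¹ =
      ∫⁻ x in Set.Ioo 0 a, ∑' n : ℕ, ENNReal.ofReal (1 * x ^ n) := by
    refine setLIntegral_congr_fun measurableSet_Ioo fun x hx => ?_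
    have hx1 : x < 1 := hx.2.trans_le ha1
    simp only [one_mul]
    rw [← tsum_geometric_of_lt_one hx.1.le hx1,
      ENNReal.ofReal_tsum_of_nonneg (fun n => pow_nonneg hx.1.le n)
        (summable_geometric_of_lt_one hx.1.le hx1)]
  rw [h, lintegral_tsum fun n => by fun_prop]
  exact tsum_congr fun n => by rw [lintegral_Ioo_const_mul_pow ha0 zero_le_one, one_mul]

theorem setLIntegral_polylogIntegrand_zero (a : ℝ) :
    ∫⁻ t in openSimplex 1 a, ENNReal.ofReal (polylogIntegrand 0 t) =
      ∫⁻ x in Set.Ioo 0 a, ENNReal.ofReal (1 - x)⁻¹ := by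
  have h : openSimplex 1 a = MeasurableEquiv.funUnique (Fin 1) ℝ ⁻¹' Set.Ioo 0 a := by
    ext t
    simp [openSimplex, Subsingleton.strictMono]
  have h2 := (volume_preserving_funUnique (Fin 1) ℝ).setLIntegral_comp_preimage
    (s := Set.Ioo 0 a) measurableSet_Ioo
    (f := fun x => ENNReal.ofReal (1 - x)⁻¹) (by fun_prop)
  rw [← h2, h]
  simp [polylogIntegrand]
  rfl

theorem setLIntegral_polylogIntegrand_succ (m : ℕ) (a : ℝ) :
    ∫⁻ t in openSimplex (m + 2) a, ENNReal.ofReal (polylogIntegrand (m + 1) t) =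
      ∫⁻ x in Set.Ioo 0 a, ENNReal.ofReal x⁻¹ *
        ∫⁻ s in openSimplex (m + 1) x, ENNReal.ofReal (polylogIntegrand m s) := by
  let S : Set (ℝ × (Fin (m + 1) → ℝ)) :=
    {p | p.1 ∈ Set.Ioo 0 a ∧ p.2 ∈ openSimplex (m + 1) p.1}
  let G : ℝ × (Fin (m + 1) → ℝ) → ENNReal :=
    S.indicator fun p => ENNReal.ofReal p.1⁻¹ * ENNReal.ofReal (polylogIntegrand m p.2)
  have hS : MeasurableSet S :=
    (measurable_fst measurableSet_Ioo).inter
      (measurableSet_setOf_mem_openSimplex measurable_snd measurable_fst)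
  have hG : Measurable G := by
    refine Measurable.indicator (Measurable.mul measurable_fst.inv.ennreal_ofReal ?_) hS
    exact ((measurable_polylogIntegrand m).comp measurable_snd).ennreal_ofReal
  have hcomp := (volume_preserving_piFinSuccAbove (fun _ : Fin (m + 2) => ℝ)
    (Fin.last (m + 1))).lintegral_comp hG
  have hfun (t : Fin (m + 2) → ℝ) :
      (openSimplex (m + 2) a).indicator
        (fun t => ENNReal.ofReal (polylogIntegrand (m + 1) t)) t =
      G (MeasurableEquiv.piFinSuccAbove (fun _ : Fin (m + 2) => ℝ) (Fin.last (m + 1)) t) := by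
    have he : MeasurableEquiv.piFinSuccAbove (fun _ : Fin (m + 2) => ℝ) (Fin.last (m + 1)) t =
        (t (Fin.last (m + 1)), fun i => t i.castSucc) := by
      ext <;> simp [MeasurableEquiv.piFinSuccAbove, Fin.init]
    rw [he]
    by_cases ht : t ∈ openSimplex (m + 2) a
    · have ht' := mem_openSimplex_succ_iff.1 ht
      rw [Set.indicator_of_mem ht]
      refine Eq.trans ?_ (Set.indicator_of_mem (s := S) ht' _).symm
      rw [polylogIntegrand_succ, ENNReal.ofReal_mul (inv_nonneg.2 ht'.1.1.le)]
    · rw [Set.indicator_of_notMem ht]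
      exact (Set.indicator_of_notMem (s := S) (fun h => ht (mem_openSimplex_succ_iff.2 h)) _).symm
  rw [← lintegral_indicator (measurableSet_openSimplex _ _), lintegral_congr hfun, hcomp,
    Measure.volume_eq_prod, lintegral_prod _ hG.aemeasurable,
    ← lintegral_indicator measurableSet_Ioo]
  refine lintegral_congr fun x => ?_
  by_cases hx : x ∈ Set.Ioo 0 a
  · rw [Set.indicator_of_mem hx, ← lintegral_const_mul' _ _ ENNReal.ofReal_ne_top,
      ← lintegral_indicator (measurableSet_openSimplex _ _)]
    refine lintegral_congr fun s => ?_
    by_cases hs : s ∈ openSimplex (m + 1) x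
    · rw [Set.indicator_of_mem hs]
      exact Set.indicator_of_mem (s := S) ⟨hx, hs⟩ _
    · rw [Set.indicator_of_notMem hs]
      exact Set.indicator_of_notMem (s := S) (fun h => hs h.2) _
  · rw [Set.indicator_of_notMem hx]
    have hG0 (s : Fin (m + 1) → ℝ) : G (x, s) = 0 :=
      Set.indicator_of_notMem (s := S) (fun h => hx h.1) _
    simp [hG0]

theorem setLIntegral_polylogIntegrand (m : ℕ) {a : ℝ} (ha0 : 0 ≤ a) (ha1 : a ≤ 1) :
    ∫⁻ t in openSimplex (m + 1) a, ENNReal.ofReal (polylogIntegrand m t) =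
      ∑' n : ℕ, ENNReal.ofReal (a ^ (n + 1) / ((n : ℝ) + 1) ^ (m + 1)) := by
  induction m generalizing a with
  | zero => simpa using
      (setLIntegral_polylogIntegrand_zero a).trans (lintegral_Ioo_inv_one_sub ha0 ha1)
  | succ m ih =>
    have h : ∫⁻ x in Set.Ioo 0 a, ENNReal.ofReal x⁻¹ *
          ∫⁻ s in openSimplex (m + 1) x, ENNReal.ofReal (polylogIntegrand m s) =
        ∫⁻ x in Set.Ioo 0 a, ∑' n : ℕ,
          ENNReal.ofReal ((((n : ℝ) + 1) ^ (m + 1))⁻¹ * x ^ n) := by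
      refine setLIntegral_congr_fun measurableSet_Ioo fun x hx => ?_
      rw [ih hx.1.le (hx.2.le.trans ha1), ← ENNReal.tsum_mul_left]
      refine tsum_congr fun n => ?_
      rw [← ENNReal.ofReal_mul (inv_nonneg.2 hx.1.le)]
      congr 1
      have := hx.1.ne'
      field_simp
      ring
    rw [setLIntegral_polylogIntegrand_succ, h, lintegral_tsum fun n => by fun_prop]
    refine tsum_congr fun n => ?_
    rw [lintegral_Ioo_const_mul_pow ha0 (by positivity)]
    congr 1
    field_simp
    ring

theorem summable_polylog {a : ℝ} (ha0 : 0 ≤ a) (ha1 : a < 1) (k : ℕ) :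
    Summable fun n : ℕ => a ^ (n + 1) / ((n : ℝ) + 1) ^ k := by
  refine Summable.of_nonneg_of_le (fun n => by positivity) (fun n => ?_)
    ((summable_nat_add_iff 1).2 (summable_geometric_of_lt_one ha0 ha1))
  exact div_le_self (by positivity) (one_le_pow₀ (by linarith [n.cast_nonneg (α := ℝ)]))

/-- For an integer `k ≥ 1` and a real `0 < a < 1`, the function
`(t₁, …, t_k) ↦ 1 / ((1 - t₁)·t₂⋯t_k)` is Lebesgue-integrable on the open simplex
`{0 < t₁ < t₂ < ⋯ < t_k < a}` and its integral equals the polylogarithm value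
`Li_k(a) = ∑_{n=1}^∞ aⁿ / n^k`. -/
theorem integral_simplex_eq_polylog
    (k : ℕ) (hk : 0 < k) (a : ℝ) (ha0 : 0 < a) (ha1 : a < 1) :
    IntegrableOn
      (fun t : Fin k → ℝ =>
        ((1 - t ⟨0, hk⟩) * ∏ i ∈ Finset.univ.erase (⟨0, hk⟩ : Fin k), t i)⁻¹)
      {t : Fin k → ℝ | (∀ i, 0 < t i ∧ t i < a) ∧ StrictMono t} volume ∧
    ∫ t : Fin k → ℝ in
        {t : Fin k → ℝ | (∀ i, 0 < t i ∧ t i < a) ∧ StrictMono t},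
      ((1 - t ⟨0, hk⟩) * ∏ i ∈ Finset.univ.erase (⟨0, hk⟩ : Fin k), t i)⁻¹
      = ∑' n : ℕ, a ^ (n + 1) / ((n : ℝ) + 1) ^ k := by
  obtain ⟨m, rfl⟩ := Nat.exists_eq_succ_of_ne_zero hk.ne'
  have hF : (fun t : Fin (m + 1) → ℝ =>
      ((1 - t ⟨0, hk⟩) * ∏ i ∈ Finset.univ.erase (⟨0, hk⟩ : Fin (m + 1)), t i)⁻¹) =
      polylogIntegrand m := by
    funext t
    have h0 : (⟨0, hk⟩ : Fin (m + 1)) = 0 := rfl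
    have he : (Finset.univ.erase (0 : Fin (m + 1))) =
        Finset.univ.map (Fin.succEmb m) := by
      ext i
      induction i using Fin.cases <;> simp
    rw [h0, he, Finset.prod_map]
    rfl
  change IntegrableOn _ (openSimplex (m + 1) a) volume ∧ ∫ t in openSimplex (m + 1) a, _ = _
  simp only [Nat.succ_eq_add_one]
  rw [hF]
  have hnn : 0 ≤ᵐ[volume.restrict (openSimplex (m + 1) a)] polylogIntegrand m := by
    filter_upwards [ae_restrict_mem (measurableSet_openSimplex _ _)] with t ht
    exact polylogIntegrand_nonneg ha1.le ht
  have hsm := (measurable_polylogIntegrand m).aestronglyMeasurable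
    (μ := volume.restrict (openSimplex (m + 1) a))
  have hpos (n : ℕ) : 0 ≤ a ^ (n + 1) / ((n : ℝ) + 1) ^ (m + 1) := by positivity
  have hL := setLIntegral_polylogIntegrand m ha0.le ha1.le
  rw [← ENNReal.ofReal_tsum_of_nonneg hpos (summable_polylog ha0.le ha1 (m + 1))] at hL
  refine ⟨⟨hsm, ?_⟩, ?_⟩
  · rw [hasFiniteIntegral_iff_ofReal hnn, hL]
    exact ENNReal.ofReal_lt_top
  · rw [integral_eq_lintegral_of_nonneg_ae hnn hsm, hL, ENNReal.toReal_ofReal (tsum_nonneg hpos)]
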